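/- (Theorem 3.1, equivalence of problem (P) to the Dirichlet problem — converse direction.) Let β and δ be real constants with β ≥ max(δ, −1−δ), set α = β − δ, and let k, a, γ, u₀ > 0. Let ξ_D be the unique positive solution of (k·u₀/(γ·2^{β+1}·a^{β+δ+2}))·f(z) = z^{β+δ+1}, with f(z) = 1/(z·M(α/2 + 1, 3/2, z²)). Fix λ ≥ 0 and u_∞ > 0 with λ·u₀ < u_∞, and define h₀ = −k·u₀·M(−α/2, 1/2, −ξ_D²) / ( 2·a·ξ_D·M(−α/2 + 1/2, 3/2, −ξ_D²)·(λ·u₀ − u_∞) ). Then the unique positive solution ξ of (k·u_∞/(γ·2^{β+1}·a^{β+δ+2}))·f_λ(z) = z^{β+δ+1}, where f_λ(z) = 1/( (k/(2·a·h₀))·M(α/2 + 1/2, 1/2, z²) + λ·z·M(α/2 + 1, 3/2, z²) ), satisfies ξ = ξ_D. -/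

import Mathlib

/-- Kummer's confluent hypergeometric function
`M(a,b,z) = ∑ (a)_n / (b)_n · zⁿ/n!`, with `(a)_n` the rising factorial. -/
noncomputable def kummerM (a b z : ℝ) : ℝ :=
  ∑' n : ℕ, ((ascPochhammer ℝ n).eval a / (ascPochhammer ℝ n).eval b) * z ^ n / (n.factorial : ℝ)

theorem abs_ascPochhammer_eval_div_le (a : ℝ) {b : ℝ} (hb : 0 < b) (n : ℕ) :
    |(ascPochhammer ℝ n).eval a / (ascPochhammer ℝ n).eval b| ≤ (1 + |a| / b) ^ n := by
  induction n with
  | zero => simp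
  | succ n ih =>
    have hbn : 0 < b + n := by positivity
    have hstep : |(a + n) / (b + n)| ≤ 1 + |a| / b := by
      rw [abs_div, abs_of_pos hbn, div_le_iff₀ hbn]
      have hsum : |a + n| ≤ |a| + n := by
        simpa using abs_add_le a (n : ℝ)
      have hexp : (1 + |a| / b) * (b + n) = b + n + |a| + |a| / b * n := by
        field_simp
        ring
      have : 0 ≤ |a| / b * n := by positivity
      linarith
    rw [ascPochhammer_succ_eval, ascPochhammer_succ_eval, mul_div_mul_comm, abs_mul, pow_succ]
    gcongr

theorem summable_norm_kummerM (a : ℝ) {b : ℝ} (hb : 0 < b) (z : ℝ) :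
    Summable fun n : ℕ ↦
      ‖((ascPochhammer ℝ n).eval a / (ascPochhammer ℝ n).eval b) * z ^ n / (n.factorial : ℝ)‖ := by
  refine Summable.of_nonneg_of_le (fun _ ↦ norm_nonneg _) (fun n ↦ ?_)
    (Real.summable_pow_div_factorial ((1 + |a| / b) * |z|))
  rw [Real.norm_eq_abs, abs_div, abs_mul, abs_pow, Nat.abs_cast, mul_pow]
  gcongr
  exact abs_ascPochhammer_eval_div_le a hb n

theorem ascPochhammer_succ_eval_left (x : ℝ) (n : ℕ) :
    (ascPochhammer ℝ (n + 1)).eval x = x * (ascPochhammer ℝ n).eval (x + 1) := by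
  simp [ascPochhammer_succ_left, Polynomial.eval_comp]

/-- A form of the Chu–Vandermonde identity. -/
theorem sum_choose_mul_ascPochhammer_eval_div (c : ℝ) (n : ℕ) {b : ℝ} (hb : 0 < b) :
    ∑ k ∈ Finset.range (n + 1), (n.choose k : ℝ) *
        ((-1) ^ k * ((ascPochhammer ℝ k).eval c / (ascPochhammer ℝ k).eval b)) =
      (ascPochhammer ℝ n).eval (b - c) / (ascPochhammer ℝ n).eval b := by
  induction n generalizing b with
  | zero => simp
  | succ n ih =>
    have hsplit := Finset.sum_choose_succ_mul
      (fun k _ ↦ (-1 : ℝ) ^ k * ((ascPochhammer ℝ k).eval c / (ascPochhammer ℝ k).eval b)) n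
    rw [hsplit, ← Finset.sum_add_distrib, ascPochhammer_succ_eval_left,
      ascPochhammer_succ_eval_left, mul_div_mul_comm, show b - c + 1 = b + 1 - c by ring,
      ← ih (by positivity), Finset.mul_sum]
    refine Finset.sum_congr rfl fun k _ ↦ ?_
    have hk : 0 < b + k := by positivity
    have hpos : 0 < (ascPochhammer ℝ k).eval b := ascPochhammer_pos k b hb
    have hpos' : 0 < (ascPochhammer ℝ k).eval (b + 1) := ascPochhammer_pos k _ (by positivity)
    have hshift : (ascPochhammer ℝ k).eval b * (b + k) = b * (ascPochhammer ℝ k).eval (b + 1) := by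
      rw [← ascPochhammer_succ_eval, ascPochhammer_succ_eval_left]
    have hb1 : (ascPochhammer ℝ k).eval (b + 1) = (ascPochhammer ℝ k).eval b * (b + k) / b := by
      rw [hshift]; field_simp
    rw [ascPochhammer_succ_eval, ascPochhammer_succ_eval, hb1]
    field_simp
    ring

/-- Kummer's transformation. -/
theorem kummerM_sub_neg (c : ℝ) {b : ℝ} (hb : 0 < b) (z : ℝ) :
    kummerM (b - c) b (-z) = Real.exp (-z) * kummerM c b z := by
  have hexp : Summable fun n : ℕ ↦ ‖(-z) ^ n / (n.factorial : ℝ)‖ := by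
    simpa only [norm_div, norm_pow, Real.norm_natCast] using
      Real.summable_pow_div_factorial ‖-z‖
  rw [mul_comm, Real.exp_eq_exp_ℝ, NormedSpace.exp_eq_tsum_div]
  unfold kummerM
  rw [tsum_mul_tsum_eq_tsum_sum_range_of_summable_norm (summable_norm_kummerM c hb z) hexp]
  refine tsum_congr fun n ↦ ?_
  rw [← sum_choose_mul_ascPochhammer_eval_div c n hb, Finset.sum_mul, Finset.sum_div]
  refine Finset.sum_congr rfl fun k hk ↦ ?_
  have hkn : k ≤ n := Nat.lt_succ_iff.mp (Finset.mem_range.mp hk)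
  have hz : (-z) ^ n = (-1) ^ k * z ^ k * (-z) ^ (n - k) := by
    rw [← mul_pow, neg_one_mul, ← pow_add, Nat.add_sub_cancel' hkn]
  have hsign : ((-1 : ℝ) ^ k) * (-1) ^ k = 1 := by rw [← mul_pow]; simp
  have h1 := Nat.factorial_ne_zero k
  have h2 := Nat.factorial_ne_zero (n - k)
  have h3 := Nat.factorial_ne_zero n
  rw [Nat.cast_choose ℝ hkn, hz]
  have hpos : 0 < (ascPochhammer ℝ k).eval b := ascPochhammer_pos k b hb
  field_simp
  linear_combination (ascPochhammer ℝ k).eval c * z ^ k * (-z) ^ (n - k) * hsign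

theorem kummerM_strictMonoOn {a b : ℝ} (ha : 0 < a) (hb : 0 < b) :
    StrictMonoOn (kummerM a b) (Set.Ici 0) := by
  intro x hx y _ hxy
  have hx : 0 ≤ x := hx
  refine Summable.tsum_lt_tsum (i := 1) (fun n ↦ ?_) ?_ (summable_norm_kummerM a hb x).of_norm
    (summable_norm_kummerM a hb y).of_norm
  · have := ascPochhammer_pos n a ha
    have := ascPochhammer_pos n b hb
    gcongr
  · simpa using mul_lt_mul_of_pos_left hxy (div_pos ha hb)

theorem kummerM_pos {a b z : ℝ} (ha : 0 < a) (hb : 0 < b) (hz : 0 ≤ z) : 0 < kummerM a b z := by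
  refine (summable_norm_kummerM a hb z).of_norm.tsum_pos (fun n ↦ ?_) 0 (by simp)
  have := ascPochhammer_pos n a ha
  have := ascPochhammer_pos n b hb
  positivity

/-- Theorem 3.1 (converse direction): if `ξ_D` is the positive root of the Dirichlet
equation and, for `λ ≥ 0`, `u_∞ > 0` with `λ·u₀ < u_∞`, the coefficient `h₀` is defined
by the equivalence formula, then `ξ_D` is the unique positive root of the equation
`(k·u_∞/(γ·2^{β+1}·a^{β+δ+2}))·f_λ(z) = z^{β+δ+1}` of problem (P), i.e. `ξ = ξ_D`. -/
theorem stmt14 (β δ k a γ u₀ : ℝ) (hβ : β ≥ max δ (-1 - δ))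
    (hk : 0 < k) (ha : 0 < a) (hγ : 0 < γ) (hu₀ : 0 < u₀)
    (α : ℝ) (hα : α = β - δ)
    (ξD : ℝ) (hξDpos : 0 < ξD)
    (hξD : (k * u₀ / (γ * (2:ℝ) ^ (β + 1) * a ^ (β + δ + 2))) *
      (1 / (ξD * kummerM (α/2 + 1) (3/2) (ξD^2))) = ξD ^ (β + δ + 1))
    (lam uinf : ℝ) (hlam : 0 ≤ lam) (huinf : 0 < uinf) (hlu : lam * u₀ < uinf)
    (h₀ : ℝ)
    (hh₀ : h₀ = -(k * u₀ * kummerM (-α/2) (1/2) (-ξD^2)) /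
      (2 * a * ξD * kummerM (-α/2 + 1/2) (3/2) (-ξD^2) * (lam * u₀ - uinf))) :
    ((k * uinf / (γ * (2:ℝ) ^ (β + 1) * a ^ (β + δ + 2))) *
      (1 / ((k / (2 * a * h₀)) * kummerM (α/2 + 1/2) (1/2) (ξD^2) +
        lam * ξD * kummerM (α/2 + 1) (3/2) (ξD^2))) = ξD ^ (β + δ + 1)) ∧
    (∀ z : ℝ, 0 < z →
      (k * uinf / (γ * (2:ℝ) ^ (β + 1) * a ^ (β + δ + 2))) *
        (1 / ((k / (2 * a * h₀)) * kummerM (α/2 + 1/2) (1/2) (z^2) +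
          lam * z * kummerM (α/2 + 1) (3/2) (z^2))) = z ^ (β + δ + 1) → z = ξD) := by
  have hα0 : 0 ≤ α := by linarith [le_max_left δ (-1 - δ)]
  have hexponent : 0 ≤ β + δ + 1 := by linarith [le_max_right δ (-1 - δ)]
  have hkummer₁ : kummerM (-α/2) (1/2) (-ξD^2) =
      Real.exp (-ξD^2) * kummerM (α/2 + 1/2) (1/2) (ξD^2) := by
    rw [← kummerM_sub_neg _ (by norm_num)]
    congr 1
    ring
  have hkummer₂ : kummerM (-α/2 + 1/2) (3/2) (-ξD^2) =
      Real.exp (-ξD^2) * kummerM (α/2 + 1) (3/2) (ξD^2) := by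
    rw [← kummerM_sub_neg _ (by norm_num)]
    congr 1
    ring
  have hA {z : ℝ} : 0 < kummerM (α/2 + 1/2) (1/2) (z^2) :=
    kummerM_pos (by positivity) (by norm_num) (by positivity)
  have hB {z : ℝ} : 0 < kummerM (α/2 + 1) (3/2) (z^2) :=
    kummerM_pos (by positivity) (by norm_num) (by positivity)
  have hgap : 0 < uinf - lam * u₀ := sub_pos.mpr hlu
  have hcoeff : k / (2 * a * h₀) = ξD * kummerM (α/2 + 1) (3/2) (ξD^2) * (uinf - lam * u₀) /
      (u₀ * kummerM (α/2 + 1/2) (1/2) (ξD^2)) := by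
    have hA' := hA (z := ξD)
    have hB' := hB (z := ξD)
    rw [hh₀, hkummer₁, hkummer₂, show lam * u₀ - uinf = -(uinf - lam * u₀) by ring]
    have hE := Real.exp_pos (-ξD^2)
    field_simp
  have hcoeff_pos : 0 < k / (2 * a * h₀) := by
    have hA' := hA (z := ξD)
    have hB' := hB (z := ξD)
    rw [hcoeff]
    positivity
  set C := k / (2 * a * h₀)
  have hroot : (k * uinf / (γ * (2:ℝ) ^ (β + 1) * a ^ (β + δ + 2))) *
      (1 / (C * kummerM (α/2 + 1/2) (1/2) (ξD^2) +
        lam * ξD * kummerM (α/2 + 1) (3/2) (ξD^2))) = ξD ^ (β + δ + 1) := by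
    have hA' := hA (z := ξD)
    have hB' := hB (z := ξD)
    have hden : C * kummerM (α/2 + 1/2) (1/2) (ξD^2) + lam * ξD * kummerM (α/2 + 1) (3/2) (ξD^2) =
        uinf / u₀ * (ξD * kummerM (α/2 + 1) (3/2) (ξD^2)) := by
      rw [hcoeff]
      generalize kummerM (α/2 + 1/2) (1/2) (ξD^2) = A at hA' ⊢
      generalize kummerM (α/2 + 1) (3/2) (ξD^2) = B at hB' ⊢
      field_simp
      ring
    rw [hden, ← hξD]
    field_simp
  refine ⟨hroot, fun z hz hzroot ↦ ?_⟩
  have hanti {x y : ℝ} (hx : 0 < x) (hxy : x < y) :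
      (k * uinf / (γ * (2:ℝ) ^ (β + 1) * a ^ (β + δ + 2))) *
        (1 / (C * kummerM (α/2 + 1/2) (1/2) (y^2) + lam * y * kummerM (α/2 + 1) (3/2) (y^2))) <
      (k * uinf / (γ * (2:ℝ) ^ (β + 1) * a ^ (β + δ + 2))) *
        (1 / (C * kummerM (α/2 + 1/2) (1/2) (x^2) + lam * x * kummerM (α/2 + 1) (3/2) (x^2))) := by
    have hy : 0 < y := hx.trans hxy
    have hsq : x ^ 2 < y ^ 2 := by gcongr
    have hAlt : kummerM (α/2 + 1/2) (1/2) (x^2) < kummerM (α/2 + 1/2) (1/2) (y^2) :=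
      kummerM_strictMonoOn (by positivity) (by norm_num) (sq_nonneg x) (sq_nonneg y) hsq
    have hBlt : kummerM (α/2 + 1) (3/2) (x^2) < kummerM (α/2 + 1) (3/2) (y^2) :=
      kummerM_strictMonoOn (by positivity) (by norm_num) (sq_nonneg x) (sq_nonneg y) hsq
    have hA' := hA (z := x)
    have hB' := hB (z := x)
    refine mul_lt_mul_of_pos_left (one_div_lt_one_div_of_lt (by positivity) ?_) (by positivity)
    refine add_lt_add_of_lt_of_le (mul_lt_mul_of_pos_left hAlt hcoeff_pos) ?_
    gcongr
  rcases lt_trichotomy z ξD with h | h | h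
  · have hlt := hanti hz h
    rw [hroot, hzroot] at hlt
    exact absurd (Real.rpow_le_rpow hz.le h.le hexponent) hlt.not_ge
  · exact h
  · have hlt := hanti hξDpos h
    rw [hroot, hzroot] at hlt
    exact absurd (Real.rpow_le_rpow hξDpos.le h.le hexponent) hlt.not_ge
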